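/- Consider a compound discrete memoryless channel with states known non-causally at the transmitter, given by finite alphabets 𝒳, 𝒮, 𝒴, a finite index set Θ, channels W : Θ → 𝒳 → 𝒮 → PMF 𝒴 and a state distribution P_S : PMF 𝒮. Let 𝒰 be a nonempty finite set and P_{XU|S} : 𝒮 → PMF (𝒳 × 𝒰) any conditional input distribution; for each θ ∈ Θ define the joint pmf on 𝒰 × 𝒮 × 𝒳 × 𝒴 by p_θ(u,s,x,y) = P_S(s) · P_{XU|S}(s)(x,u) · (W θ x s)(y). Then the rate R = max(0, min_{θ∈Θ} [ I(U;Y_θ) − I(U;S) ]) is achievable, where the mutual informations are computed from p_θ (I(U;S) does not depend on θ). -/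

import Mathlib

open scoped BigOperators

noncomputable section

namespace CompoundGP

variable {𝒳 𝒮 𝒴 : Type} [Fintype 𝒳] [Fintype 𝒮] [Fintype 𝒴]

/-- Mutual information `I(A;B)` of a joint (real-valued) pmf `p` on `A × B`,
with natural logarithm and the convention `0·log(·) = 0`. -/
def mutualInfo {A B : Type} [Fintype A] [Fintype B] (p : A × B → ℝ) : ℝ :=
  ∑ a : A, ∑ b : B,
    p (a, b) *
      Real.log (p (a, b) / ((∑ b' : B, p (a, b')) * (∑ a' : A, p (a', b))))

/-- Average (over i.i.d. states with pmf `PS`) error probability of message `m`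
for the channel component `θ`, for the `(n,M)` code `(φ, ψ)`. -/
def avgError {Θ : Type} (W : Θ → 𝒳 → 𝒮 → PMF 𝒴) (PS : PMF 𝒮) {n M : ℕ}
    (φ : Fin M → (Fin n → 𝒮) → (Fin n → 𝒳)) (ψ : (Fin n → 𝒴) → Fin M)
    (m : Fin M) (θ : Θ) : ℝ :=
  ∑ s : Fin n → 𝒮, (∏ i, (PS (s i)).toReal) *
    ∑ y : Fin n → 𝒴,
      (∏ i, ((W θ (φ m s i) (s i)) (y i)).toReal) * (if ψ y ≠ m then 1 else 0)

/-- `R` is an achievable rate for the compound DMC `{W θ}` with i.i.d. states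
(pmf `PS`) known non-causally at the transmitter only: for every
`ε, γ ∈ (0,1)` and all large enough `n` there is an `(n,M)` code of rate
`(log M)/n ≥ R − γ` whose maximum (over messages and components) average error
probability is at most `ε`. -/
def IsAchievable {Θ : Type} (W : Θ → 𝒳 → 𝒮 → PMF 𝒴) (PS : PMF 𝒮) (R : ℝ) : Prop :=
  0 ≤ R ∧
    ∀ ε ∈ Set.Ioo (0 : ℝ) 1, ∀ γ ∈ Set.Ioo (0 : ℝ) 1, ∃ n₀ : ℕ, ∀ n ≥ n₀,
      ∃ M : ℕ, 1 ≤ M ∧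
        ∃ (φ : Fin M → (Fin n → 𝒮) → (Fin n → 𝒳)) (ψ : (Fin n → 𝒴) → Fin M),
          Real.log M / n ≥ R - γ ∧ ∀ m θ, avgError W PS φ ψ m θ ≤ ε

/-- Real-valued indicator of a proposition. -/
def ind (P : Prop) : ℝ := by
  classical exact if P then 1 else 0

lemma ind_true {P : Prop} (h : P) : ind P = 1 := by simp [ind, h]

lemma ind_false {P : Prop} (h : ¬ P) : ind P = 0 := by simp [ind, h]

lemma ind_nonneg (P : Prop) : 0 ≤ ind P := by
  by_cases h : P
  · rw [ind_true h]; norm_num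
  · rw [ind_false h]

lemma ind_le_one (P : Prop) : ind P ≤ 1 := by
  by_cases h : P
  · rw [ind_true h]
  · rw [ind_false h]; norm_num

lemma ind_mono {P Q : Prop} (h : P → Q) : ind P ≤ ind Q := by
  by_cases hp : P
  · rw [ind_true hp, ind_true (h hp)]
  · rw [ind_false hp]; exact ind_nonneg _

lemma ind_not (P : Prop) : ind (¬ P) = 1 - ind P := by
  by_cases hp : P
  · rw [ind_true hp, ind_false (not_not.mpr hp)]; norm_num
  · rw [ind_false hp, ind_true hp]; norm_num

lemma ind_or_le (P Q : Prop) : ind (P ∨ Q) ≤ ind P + ind Q := by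
  by_cases hp : P
  · rw [ind_true hp, ind_true (Or.inl hp)]; linarith [ind_nonneg Q]
  · rw [ind_false hp, zero_add]
    exact ind_mono (fun h => h.resolve_left hp)

lemma ind_forall {ι : Type} [Fintype ι] (P : ι → Prop) :
    ind (∀ i, P i) = ∏ i, ind (P i) := by
  by_cases h : ∀ i, P i
  · rw [ind_true h, Finset.prod_eq_one]
    intro i _; exact ind_true (h i)
  · rw [ind_false h]
    push Not at h
    obtain ⟨i, hi⟩ := h
    exact (Finset.prod_eq_zero (Finset.mem_univ i) (ind_false hi)).symm

lemma ind_exists_le {ι : Type} [Fintype ι] (P : ι → Prop) :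
    ind (∃ i, P i) ≤ ∑ i, ind (P i) := by
  by_cases h : ∃ i, P i
  · rw [ind_true h]
    obtain ⟨i, hi⟩ := h
    rw [← ind_true hi]
    exact Finset.single_le_sum (f := fun i => ind (P i)) (fun j _ => ind_nonneg _)
      (Finset.mem_univ i)
  · rw [ind_false h]
    exact Finset.sum_nonneg (fun j _ => ind_nonneg _)

lemma sum_pi_prod {ι α : Type} [Fintype ι] [DecidableEq ι] [Fintype α] (f : ι → α → ℝ) :
    ∑ c : ι → α, ∏ i, f i (c i) = ∏ i, ∑ a, f i a := (Fintype.prod_sum f).symm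

lemma sum_pi_one {ι α : Type} [Fintype ι] [DecidableEq ι] [Fintype α] (w : α → ℝ)
    (hw : ∑ a, w a = 1) :
    ∑ c : ι → α, ∏ i, w (c i) = 1 := by
  rw [sum_pi_prod (fun _ => w)]
  simp [hw]

lemma E_all {ι α : Type} [Fintype ι] [DecidableEq ι] [Fintype α] (w h : α → ℝ) :
    ∑ c : ι → α, (∏ i, w (c i)) * ∏ i, h (c i) = (∑ a, w a * h a) ^ (Fintype.card ι) := by
  simp_rw [← Finset.prod_mul_distrib]
  rw [sum_pi_prod (fun _ a => w a * h a)]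
  simp

lemma E_one {ι α : Type} [Fintype ι] [DecidableEq ι] [Fintype α] (w : α → ℝ)
    (hw : ∑ a, w a = 1) (i0 : ι) (F : α → ℝ) :
    ∑ c : ι → α, (∏ i, w (c i)) * F (c i0) = ∑ a, w a * F a := by
  have h1 : ∀ c : ι → α, F (c i0) = ∏ i, (if i = i0 then F (c i) else 1) := by
    intro c; simp
  simp_rw [h1, ← Finset.prod_mul_distrib]
  rw [sum_pi_prod (fun i a => w a * if i = i0 then F a else 1)]
  rw [Finset.prod_eq_single i0]
  · simp
  · intro b _ hb; simp [hb, hw]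
  · simp

lemma E_two {ι α : Type} [Fintype ι] [DecidableEq ι] [Fintype α] (w : α → ℝ)
    (hw : ∑ a, w a = 1) (i0 i1 : ι) (hne : i0 ≠ i1) (F H : α → ℝ) :
    ∑ c : ι → α, (∏ i, w (c i)) * (F (c i0) * H (c i1))
      = (∑ a, w a * F a) * (∑ a, w a * H a) := by
  have h1 : ∀ c : ι → α, F (c i0) * H (c i1) =
      ∏ i, ((if i = i0 then F (c i) else 1) * (if i = i1 then H (c i) else 1)) := by
    intro c; rw [Finset.prod_mul_distrib]; simp
  simp_rw [h1, ← Finset.prod_mul_distrib]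
  rw [sum_pi_prod (fun i a => w a * ((if i = i0 then F a else 1) * (if i = i1 then H a else 1)))]
  rw [Finset.prod_eq_mul i0 i1 hne]
  · simp [hne, hne.symm]
  · intro b _ hb; simp [hb.1, hb.2, hw]
  · simp
  · simp

lemma chernoff {Z : Type} [Fintype Z] (p f : Z → ℝ) (hp : ∀ z, 0 ≤ p z) (hs : ∑ z, p z = 1)
    (a : ℝ) (ha : ∑ z, p z * f z < a) :
    ∃ ρ : ℝ, 0 ≤ ρ ∧ ρ < 1 ∧ ∀ n : ℕ,
      ∑ z : Fin n → Z, (∏ i, p (z i)) * ind ((n : ℝ) * a ≤ ∑ i, f (z i)) ≤ ρ ^ n := by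
  set g : Z → ℝ := fun z => f z - a with hg
  set μ : ℝ := ∑ z, p z * g z with hμ
  have hμ0 : μ < 0 := by
    have : μ = ∑ z, p z * f z - a := by
      rw [hμ]; simp only [hg, mul_sub, Finset.sum_sub_distrib, ← Finset.sum_mul, hs, one_mul]
    linarith
  set B : ℝ := 1 + ∑ z, |g z| with hB
  have hB1 : 1 ≤ B := by
    have : 0 ≤ ∑ z, |g z| := Finset.sum_nonneg (fun _ _ => abs_nonneg _)
    linarith
  have hgB : ∀ z, |g z| ≤ B := by
    intro z
    have := Finset.single_le_sum (f := fun z => |g z|) (fun _ _ => abs_nonneg _) (Finset.mem_univ z)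
    linarith
  obtain ⟨t, ht0, htB, htμ⟩ : ∃ t : ℝ, 0 < t ∧ t * B ≤ 1 ∧ t * B ^ 2 < -μ := by
    have hB2 : 0 < B ^ 2 := by positivity
    refine ⟨min (1 / B) (-μ / (2 * B ^ 2)), ?_, ?_, ?_⟩
    · apply lt_min
      · positivity
      · apply div_pos <;> linarith
    · calc _ ≤ (1 / B) * B := by gcongr; exact min_le_left _ _
        _ = 1 := by field_simp
    · calc _ ≤ (-μ / (2 * B ^ 2)) * B ^ 2 := by gcongr; exact min_le_right _ _
        _ = -μ / 2 := by field_simp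
        _ < -μ := by linarith
  refine ⟨∑ z, p z * Real.exp (t * g z), ?_, ?_, ?_⟩
  · exact Finset.sum_nonneg (fun z _ => mul_nonneg (hp z) (Real.exp_nonneg _))
  · have hb : ∀ z, p z * Real.exp (t * g z) ≤ p z + t * (p z * g z) + p z * (t ^ 2 * B ^ 2) := by
      intro z
      have h1 : |t * g z| ≤ 1 := by
        rw [abs_mul, abs_of_pos ht0]
        exact le_trans (by gcongr; exact hgB z) htB
      have h2 := (abs_le.mp (Real.abs_exp_sub_one_sub_id_le h1)).2
      have h3 : (t * g z) ^ 2 ≤ t ^ 2 * B ^ 2 := by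
        rw [mul_pow]
        refine mul_le_mul_of_nonneg_left ?_ (sq_nonneg t)
        exact sq_le_sq' (by linarith [(abs_le.mp (hgB z)).1]) (abs_le.mp (hgB z)).2
      have h4 : Real.exp (t * g z) ≤ 1 + t * g z + t ^ 2 * B ^ 2 := by linarith
      calc _ ≤ p z * (1 + t * g z + t ^ 2 * B ^ 2) := mul_le_mul_of_nonneg_left h4 (hp z)
        _ = _ := by ring
    calc _ ≤ ∑ z, (p z + t * (p z * g z) + p z * (t ^ 2 * B ^ 2)) :=
          Finset.sum_le_sum (fun z _ => hb z)
      _ = 1 + t * μ + t ^ 2 * B ^ 2 := by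
          rw [Finset.sum_add_distrib, Finset.sum_add_distrib, ← Finset.mul_sum, ← Finset.sum_mul, hs,
            one_mul]
      _ < 1 := by nlinarith
  · intro n
    have := E_all (ι := Fin n) p (fun z => Real.exp (t * g z))
    rw [Fintype.card_fin] at this
    rw [← this]
    apply Finset.sum_le_sum
    intro z _
    apply mul_le_mul_of_nonneg_left _ (Finset.prod_nonneg (fun i _ => hp _))
    rw [← Real.exp_sum]
    by_cases h : (n : ℝ) * a ≤ ∑ i, f (z i)
    · rw [ind_true h]
      apply Real.one_le_exp
      rw [← Finset.mul_sum]
      apply mul_nonneg ht0.le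
      simp only [hg, Finset.sum_sub_distrib]
      simp
      linarith
    · rw [ind_false h]; exact Real.exp_nonneg _

lemma sum_pair_fn {A B : Type} [Fintype A] [Fintype B] (n : ℕ)
    (F : (Fin n → A) → (Fin n → B) → ℝ) :
    ∑ u : Fin n → A, ∑ v : Fin n → B, F u v
      = ∑ z : Fin n → A × B, F (fun i => (z i).1) (fun i => (z i).2) := by
  rw [← Fintype.sum_prod_type']
  exact (Equiv.sum_comp (Equiv.arrowProdEquivProdArrow (Fin n) (fun _ => A) (fun _ => B))
    (fun x => F x.1 x.2)).symm

section MI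
set_option linter.unusedSectionVars false
variable {A B : Type} [Fintype A] [Fintype B] (p : A × B → ℝ)

lemma marg_pos_left (hp : ∀ z, 0 ≤ p z) {a : A} {b : B} (h : 0 < p (a, b)) :
    0 < ∑ b' : B, p (a, b') :=
  lt_of_lt_of_le h (Finset.single_le_sum (f := fun b' => p (a, b')) (fun _ _ => hp _)
    (Finset.mem_univ b))

lemma marg_pos_right (hp : ∀ z, 0 ≤ p z) {a : A} {b : B} (h : 0 < p (a, b)) :
    0 < ∑ a' : A, p (a', b) :=
  lt_of_lt_of_le h (Finset.single_le_sum (f := fun a' => p (a', b)) (fun _ _ => hp _)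
    (Finset.mem_univ a))

lemma mutualInfo_nonneg (hp : ∀ z, 0 ≤ p z) (hs : ∑ z, p z = 1) : 0 ≤ mutualInfo p := by
  have h1 : ∑ a, ∑ b, (p (a, b) - (∑ b' : B, p (a, b')) * (∑ a' : A, p (a', b))) = 0 := by
    simp only [Finset.sum_sub_distrib, ← Finset.mul_sum]
    rw [← Finset.sum_mul, Finset.sum_comm (f := fun b a' => p (a', b)),
      ← Fintype.sum_prod_type, hs]
    norm_num
  rw [← h1]
  unfold mutualInfo
  apply Finset.sum_le_sum; intro a _
  apply Finset.sum_le_sum; intro b _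
  rcases (hp (a, b)).eq_or_lt with h | h
  · rw [← h]
    have := mul_nonneg (Finset.sum_nonneg (fun b' (_ : b' ∈ Finset.univ) => hp (a, b')))
      (Finset.sum_nonneg (fun a' (_ : a' ∈ Finset.univ) => hp (a', b)))
    simp only [zero_mul]
    linarith
  · have ha := marg_pos_left p hp h
    have hb := marg_pos_right p hp h
    have := Real.one_sub_inv_le_log_of_pos (div_pos h (mul_pos ha hb))
    have h2 := mul_le_mul_of_nonneg_left this h.le
    refine le_trans (le_of_eq ?_) h2
    field_simp

/-- log-likelihood ratio -/
def llr (z : A × B) : ℝ :=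
  Real.log (p z / ((∑ b' : B, p (z.1, b')) * (∑ a' : A, p (a', z.2))))

lemma sum_llr : ∑ z, p z * llr p z = mutualInfo p := by
  rw [Fintype.sum_prod_type]; rfl

lemma llr_prod (hp : ∀ z, 0 ≤ p z) {n : ℕ} (u : Fin n → A) (v : Fin n → B)
    (h : 0 < ∏ i, p (u i, v i)) :
    ∏ i, p (u i, v i) = Real.exp (∑ i, llr p (u i, v i)) *
      ((∏ i, ∑ b' : B, p (u i, b')) * ∏ i, ∑ a' : A, p (a', v i)) := by
  have hpos : ∀ i, 0 < p (u i, v i) := by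
    intro i
    refine lt_of_le_of_ne (hp _) (fun h0 => ?_)
    rw [Finset.prod_eq_zero (Finset.mem_univ i) h0.symm] at h
    exact lt_irrefl _ h
  rw [Real.exp_sum, ← Finset.prod_mul_distrib, ← Finset.prod_mul_distrib]
  apply Finset.prod_congr rfl
  intro i _
  have ha := marg_pos_left p hp (hpos i)
  have hb := marg_pos_right p hp (hpos i)
  unfold llr
  simp only
  rw [Real.exp_log (div_pos (hpos i) (mul_pos ha hb))]
  field_simp

lemma mi_upper (hp : ∀ z, 0 ≤ p z) (hs : ∑ z, p z = 1) (a : ℝ) (ha : mutualInfo p < a) :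
    ∃ ρ : ℝ, 0 ≤ ρ ∧ ρ < 1 ∧ ∀ n : ℕ,
      ∑ u : Fin n → A, ∑ v : Fin n → B, (∏ i, p (u i, v i)) *
        ind (¬ (∏ i, p (u i, v i) ≤ Real.exp (n * a) *
          ((∏ i, ∑ b' : B, p (u i, b')) * ∏ i, ∑ a' : A, p (a', v i)))) ≤ ρ ^ n := by
  obtain ⟨ρ, h0, h1, h⟩ := chernoff p (llr p) hp hs a (by rwa [sum_llr])
  refine ⟨ρ, h0, h1, fun n => le_trans ?_ (h n)⟩
  rw [sum_pair_fn]
  apply Finset.sum_le_sum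
  intro z _
  rcases (Finset.prod_nonneg (fun i _ => hp (z i)) : 0 ≤ ∏ i, p (z i)).eq_or_lt with h | h
  · simp [← h]
  · apply mul_le_mul_of_nonneg_left _ h.le
    apply ind_mono
    intro hn
    by_contra hc
    apply hn
    have := llr_prod p hp (fun i => (z i).1) (fun i => (z i).2) h
    rw [this]
    push Not at hc
    apply mul_le_mul_of_nonneg_right
    · exact Real.exp_le_exp.mpr hc.le
    · exact mul_nonneg (Finset.prod_nonneg fun i _ => Finset.sum_nonneg fun _ _ => hp _)
        (Finset.prod_nonneg fun i _ => Finset.sum_nonneg fun _ _ => hp _)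

lemma mi_lower (hp : ∀ z, 0 ≤ p z) (hs : ∑ z, p z = 1) (a : ℝ) (ha : a < mutualInfo p) :
    ∃ ρ : ℝ, 0 ≤ ρ ∧ ρ < 1 ∧ ∀ n : ℕ,
      ∑ u : Fin n → A, ∑ v : Fin n → B, (∏ i, p (u i, v i)) *
        ind (¬ (0 < ∏ i, p (u i, v i) ∧ Real.exp (n * a) *
          ((∏ i, ∑ b' : B, p (u i, b')) * ∏ i, ∑ a' : A, p (a', v i)) ≤ ∏ i, p (u i, v i)))
          ≤ ρ ^ n := by
  obtain ⟨ρ, h0, h1, h⟩ := chernoff p (fun z => - llr p z) hp hs (-a) (by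
    simp only [mul_neg, Finset.sum_neg_distrib]
    rw [sum_llr]; linarith)
  refine ⟨ρ, h0, h1, fun n => le_trans ?_ (h n)⟩
  rw [sum_pair_fn]
  apply Finset.sum_le_sum
  intro z _
  rcases (Finset.prod_nonneg (fun i _ => hp (z i)) : 0 ≤ ∏ i, p (z i)).eq_or_lt with h | h
  · simp [← h]
  · apply mul_le_mul_of_nonneg_left _ h.le
    apply ind_mono
    intro hn
    by_contra hc
    apply hn
    refine ⟨h, ?_⟩
    have := llr_prod p hp (fun i => (z i).1) (fun i => (z i).2) h
    rw [this]
    simp only [Finset.sum_neg_distrib] at hc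
    push Not at hc
    apply mul_le_mul_of_nonneg_right
    · apply Real.exp_le_exp.mpr
      simp only [Prod.mk.eta]
      linarith
    · exact mul_nonneg (Finset.prod_nonneg fun i _ => Finset.sum_nonneg fun _ _ => hp _)
        (Finset.prod_nonneg fun i _ => Finset.sum_nonneg fun _ _ => hp _)

end MI

lemma covering {U : Type} [Fintype U] (q k : U → ℝ) (hq0 : ∀ u, 0 ≤ q u) (hq1 : ∑ u, q u = 1)
    (hk0 : ∀ u, 0 ≤ k u) (hk1 : ∑ u, k u = 1) (G : U → Prop) (T : ℝ) (hT : 0 < T)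
    (hG : ∀ u, G u → k u ≤ T * q u) (L : ℕ) :
    (∑ u, q u * ind (¬ G u)) ^ L ≤ ∑ u, k u * ind (¬ G u) + Real.exp (-(L / T)) := by
  set b := ∑ u, k u * ind (G u) with hb
  set a := ∑ u, q u * ind (G u) with ha
  have h1 : ∑ u, q u * ind (¬ G u) = 1 - a := by
    simp only [ind_not, mul_sub, mul_one, Finset.sum_sub_distrib, hq1, ha]
  have h2 : ∑ u, k u * ind (¬ G u) = 1 - b := by
    simp only [ind_not, mul_sub, mul_one, Finset.sum_sub_distrib, hk1, hb]
  have hb0 : 0 ≤ b := Finset.sum_nonneg fun u _ => mul_nonneg (hk0 u) (ind_nonneg _)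
  have hb1 : 0 ≤ 1 - b := by
    rw [← h2]; exact Finset.sum_nonneg fun u _ => mul_nonneg (hk0 u) (ind_nonneg _)
  have ha1 : 0 ≤ 1 - a := by
    rw [← h1]; exact Finset.sum_nonneg fun u _ => mul_nonneg (hq0 u) (ind_nonneg _)
  have hab : b ≤ T * a := by
    rw [hb, ha, Finset.mul_sum]
    apply Finset.sum_le_sum
    intro u _
    by_cases h : G u
    · rw [ind_true h]; linarith [hG u h]
    · rw [ind_false h]; simp
  have hab2 : b / T ≤ a := by rw [div_le_iff₀ hT]; linarith
  rw [h1, h2]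
  have h3 : 1 - a ≤ Real.exp (-(b / T)) :=
    (Real.one_sub_le_exp_neg a).trans (Real.exp_le_exp.mpr (by linarith))
  have h4 := convexOn_exp.2 (Set.mem_univ (-((L : ℝ) / T))) (Set.mem_univ (0 : ℝ)) hb0 hb1 (by ring)
  simp only [smul_eq_mul, mul_zero, add_zero, Real.exp_zero, mul_one] at h4
  have hE := Real.exp_pos (-((L : ℝ) / T))
  calc (1 - a) ^ L ≤ (Real.exp (-(b / T))) ^ L := pow_le_pow_left₀ ha1 h3 L
    _ = Real.exp (b * -(L / T)) := by
        rw [← Real.exp_nat_mul]; congr 1; ring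
    _ ≤ b * Real.exp (-(L / T)) + (1 - b) := h4
    _ ≤ _ := by nlinarith

section OneShot

variable {U S X Y Θ : Type} [Fintype U] [Fintype S] [Fintype X] [Fintype Y] [Fintype Θ]

lemma oneshot [Nonempty X]
    (PS : S → ℝ) (hPS0 : ∀ s, 0 ≤ PS s) (hPS1 : ∑ s, PS s = 1)
    (q : U → ℝ) (hq0 : ∀ u, 0 ≤ q u) (hq1 : ∑ u, q u = 1)
    (K : S → X → U → ℝ) (hK0 : ∀ s x u, 0 ≤ K s x u) (hK1 : ∀ s, ∑ u, ∑ x, K s x u = 1)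
    (W : Θ → X → S → Y → ℝ) (hW0 : ∀ θ x s y, 0 ≤ W θ x s y) (hW1 : ∀ θ x s, ∑ y, W θ x s y = 1)
    (A : U → Y → Prop) (T β δ1 δ2 η : ℝ) (hT : 0 < T) (hη : 0 < η) (hβ0 : 0 ≤ β)
    (hβ : ∀ y, ∑ u, q u * ind (A u y) ≤ β)
    (h1 : ∑ u, ∑ s, (PS s * ∑ x, K s x u) *
      ind (¬ (PS s * ∑ x, K s x u ≤ T * (q u * PS s))) ≤ δ1)
    (h2 : ∑ θ, ∑ u, ∑ y, (∑ s, ∑ x, PS s * K s x u * W θ x s y) * ind (¬ A u y) ≤ δ2)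
    (M L : ℕ) (hM : 1 ≤ M) :
    ∃ (φ : Fin M → S → X) (ψ : Y → Fin M),
      ∑ m, ∑ θ, ∑ s, PS s * ∑ y, W θ (φ m s) s y * ind (ψ y ≠ m) ≤
        M * (Fintype.card Θ * (δ1 + δ2 / η + Real.exp (-(L / T))) + η
          + Fintype.card Θ * (M * (L * β))) := by
  classical
  set N : ℝ := (Fintype.card Θ : ℝ) with hN
  -- conditional decoding failure
  set g : U → S → X → ℝ := fun u s x => ∑ θ, ∑ y, W θ x s y * ind (¬ A u y) with hg
  have hg0 : ∀ u s x, 0 ≤ g u s x := fun u s x => Finset.sum_nonneg fun θ _ =>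
    Finset.sum_nonneg fun y _ => mul_nonneg (hW0 _ _ _ _) (ind_nonneg _)
  set k : S → U → ℝ := fun s u => ∑ x, K s x u with hk
  have hk0 : ∀ s u, 0 ≤ k s u := fun s u => Finset.sum_nonneg fun x _ => hK0 s x u
  set G : U → S → Prop := fun u s => PS s * k s u ≤ T * (q u * PS s) ∧ ∃ x, g u s x ≤ η with hG
  -- probability that G fails
  have hGfail : ∑ s, PS s * ∑ u, k s u * ind (¬ G u s) ≤ δ1 + δ2 / η := by
    have hb : ∀ s u, PS s * (k s u * ind (¬ G u s)) ≤
        (PS s * k s u) * ind (¬ (PS s * k s u ≤ T * (q u * PS s))) +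
          (∑ x, PS s * K s x u * g u s x) / η := by
      intro s u
      have hr : 0 ≤ (∑ x, PS s * K s x u * g u s x) / η :=
        div_nonneg (Finset.sum_nonneg fun x _ => mul_nonneg (mul_nonneg (hPS0 s) (hK0 s x u))
          (hg0 u s x)) hη.le
      have hl : 0 ≤ PS s * k s u := mul_nonneg (hPS0 s) (hk0 s u)
      have hl2 : 0 ≤ (PS s * k s u) * ind (¬ (PS s * k s u ≤ T * (q u * PS s))) :=
        mul_nonneg hl (ind_nonneg _)
      by_cases hGG : G u s
      · rw [ind_false (not_not.mpr hGG)]; simp only [mul_zero]; linarith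
      · rw [ind_true hGG]
        by_cases hc : PS s * k s u ≤ T * (q u * PS s)
        · have hx : ∀ x, η < g u s x := by
            intro x; by_contra hx; exact hGG ⟨hc, x, not_lt.mp hx⟩
          have : PS s * k s u ≤ (∑ x, PS s * K s x u * g u s x) / η := by
            rw [le_div_iff₀ hη, hk, Finset.mul_sum, Finset.sum_mul]
            apply Finset.sum_le_sum
            intro x _
            exact mul_le_mul_of_nonneg_left (hx x).le (mul_nonneg (hPS0 s) (hK0 s x u))
          linarith
        · rw [ind_true hc]; linarith
    have e2 : ∑ s, ∑ u, (∑ x, PS s * K s x u * g u s x) =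
        ∑ θ, ∑ u, ∑ y, (∑ s, ∑ x, PS s * K s x u * W θ x s y) * ind (¬ A u y) := by
      simp only [hg, Finset.sum_mul, Finset.mul_sum]
      rw [Finset.sum_comm]
      have : ∀ u, ∑ s, ∑ x, ∑ θ, ∑ y, PS s * K s x u * (W θ x s y * ind (¬ A u y)) =
          ∑ θ, ∑ y, ∑ s, ∑ x, PS s * K s x u * W θ x s y * ind (¬ A u y) := by
        intro u
        calc _ = ∑ s, ∑ θ, ∑ x, ∑ y, PS s * K s x u * (W θ x s y * ind (¬ A u y)) :=
              Finset.sum_congr rfl fun s _ => Finset.sum_comm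
          _ = ∑ θ, ∑ s, ∑ x, ∑ y, PS s * K s x u * (W θ x s y * ind (¬ A u y)) :=
              Finset.sum_comm
          _ = ∑ θ, ∑ s, ∑ y, ∑ x, PS s * K s x u * (W θ x s y * ind (¬ A u y)) :=
              Finset.sum_congr rfl fun θ _ => Finset.sum_congr rfl fun s _ => Finset.sum_comm
          _ = ∑ θ, ∑ y, ∑ s, ∑ x, PS s * K s x u * (W θ x s y * ind (¬ A u y)) :=
              Finset.sum_congr rfl fun θ _ => Finset.sum_comm
          _ = _ := by simp only [mul_assoc]
      rw [Finset.sum_congr rfl fun u _ => this u, Finset.sum_comm]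
    calc _ = ∑ s, ∑ u, PS s * (k s u * ind (¬ G u s)) := by simp only [Finset.mul_sum]
      _ ≤ ∑ s, ∑ u, ((PS s * k s u) * ind (¬ (PS s * k s u ≤ T * (q u * PS s))) +
          (∑ x, PS s * K s x u * g u s x) / η) :=
          Finset.sum_le_sum fun s _ => Finset.sum_le_sum fun u _ => hb s u
      _ = (∑ u, ∑ s, (PS s * k s u) * ind (¬ (PS s * k s u ≤ T * (q u * PS s)))) +
          (∑ s, ∑ u, (∑ x, PS s * K s x u * g u s x)) / η := by
          simp only [Finset.sum_add_distrib, Finset.sum_div]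
          rw [Finset.sum_comm]
      _ ≤ δ1 + δ2 / η := by
          rw [e2]
          gcongr
  have hcov : ∑ s, PS s * (∑ u, q u * ind (¬ G u s)) ^ L ≤
      δ1 + δ2 / η + Real.exp (-(L / T)) := by
    have hb : ∀ s, PS s * (∑ u, q u * ind (¬ G u s)) ^ L ≤
        PS s * ∑ u, k s u * ind (¬ G u s) + PS s * Real.exp (-(L / T)) := by
      intro s
      rcases (hPS0 s).eq_or_lt with h | h
      · simp [← h]
      · rw [← mul_add]
        apply mul_le_mul_of_nonneg_left _ h.le
        apply covering q (k s) hq0 hq1 (hk0 s) (hK1 s) (fun u => G u s) T hT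
        intro u hu
        have := hu.1
        by_contra hc
        push Not at hc
        nlinarith
    calc _ ≤ ∑ s, (PS s * ∑ u, k s u * ind (¬ G u s) + PS s * Real.exp (-(L / T))) :=
          Finset.sum_le_sum fun s _ => hb s
      _ = ∑ s, PS s * ∑ u, k s u * ind (¬ G u s) + Real.exp (-(L / T)) := by
          rw [Finset.sum_add_distrib, ← Finset.sum_mul, hPS1, one_mul]
      _ ≤ _ := by linarith
  -- encoder
  have henc : ∀ (c : Fin L → U) (s : S), ∃ x : X, (∃ l, G (c l) s) → ∃ l, g (c l) s x ≤ η := by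
    intro c s
    by_cases h : ∃ l, G (c l) s
    · obtain ⟨l, hl⟩ := h
      obtain ⟨x, hx⟩ := hl.2
      exact ⟨x, fun _ => ⟨l, hx⟩⟩
    · exact ⟨Classical.arbitrary X, fun h' => absurd h' h⟩
  choose enc henc using henc
  -- decoder
  have hdec : ∀ (C : Fin M → Fin L → U) (y : Y), ∃ m : Fin M,
      (∃ m l, A (C m l) y) → ∃ l, A (C m l) y := by
    intro C y
    by_cases h : ∃ m l, A (C m l) y
    · obtain ⟨m, hm⟩ := h
      exact ⟨m, fun _ => hm⟩
    · exact ⟨⟨0, hM⟩, fun h' => absurd h' h⟩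
  choose dec hdec using hdec
  -- pointwise bound
  have hpt : ∀ (C : Fin M → Fin L → U) (m : Fin M) (s : S),
      ∑ θ, ∑ y, W θ (enc (C m) s) s y * ind (dec C y ≠ m) ≤
        N * ind (∀ l, ¬ G (C m l) s) + η +
          ∑ m' ∈ Finset.univ.erase m, ∑ θ, ∑ y,
            W θ (enc (C m) s) s y * ∑ l, ind (A (C m' l) y) := by
    intro C m s
    have h3 : 0 ≤ ∑ m' ∈ Finset.univ.erase m, ∑ θ, ∑ y,
            W θ (enc (C m) s) s y * ∑ l, ind (A (C m' l) y) :=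
      Finset.sum_nonneg fun m' _ => Finset.sum_nonneg fun θ _ => Finset.sum_nonneg fun y _ =>
        mul_nonneg (hW0 _ _ _ _) (Finset.sum_nonneg fun l _ => ind_nonneg _)
    by_cases h : ∃ l, G (C m l) s
    · obtain ⟨l, hl⟩ := henc (C m) s h
      have hind : ∀ y, ind (dec C y ≠ m) ≤ ind (¬ A (C m l) y) +
          ∑ m' ∈ Finset.univ.erase m, ∑ l, ind (A (C m' l) y) := by
        intro y
        have hnn : ∀ m' ∈ Finset.univ.erase m, 0 ≤ ∑ l, ind (A (C m' l) y) :=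
          fun m' _ => Finset.sum_nonneg fun l _ => ind_nonneg _
        by_cases hA : A (C m l) y
        · by_cases hd : dec C y = m
          · rw [ind_false (not_not.mpr hd)]
            have := Finset.sum_nonneg hnn
            linarith [ind_nonneg (¬ A (C m l) y)]
          · obtain ⟨l', hl'⟩ := hdec C y ⟨m, l, hA⟩
            have e1 := Finset.single_le_sum hnn
              (Finset.mem_erase.mpr ⟨hd, Finset.mem_univ (dec C y)⟩)
            have e2 := Finset.single_le_sum (f := fun l => ind (A (C (dec C y) l) y))
              (fun l _ => ind_nonneg _) (Finset.mem_univ l')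
            simp only [ind_true hl'] at e2
            linarith [ind_nonneg (¬ A (C m l) y), ind_le_one (dec C y ≠ m)]
        · rw [ind_true hA]
          have := Finset.sum_nonneg hnn
          linarith [ind_le_one (dec C y ≠ m)]
      have : ∑ θ, ∑ y, W θ (enc (C m) s) s y * ind (dec C y ≠ m) ≤
          g (C m l) s (enc (C m) s) + ∑ m' ∈ Finset.univ.erase m, ∑ θ, ∑ y,
            W θ (enc (C m) s) s y * ∑ l, ind (A (C m' l) y) := by
        calc _ ≤ ∑ θ, ∑ y, W θ (enc (C m) s) s y * (ind (¬ A (C m l) y) +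
              ∑ m' ∈ Finset.univ.erase m, ∑ l, ind (A (C m' l) y)) :=
              Finset.sum_le_sum fun θ _ => Finset.sum_le_sum fun y _ =>
                mul_le_mul_of_nonneg_left (hind y) (hW0 _ _ _ _)
          _ = _ := by
              simp only [mul_add, Finset.sum_add_distrib, hg]
              congr 1
              symm
              rw [Finset.sum_comm]
              apply Finset.sum_congr rfl; intro θ _
              rw [Finset.sum_comm]
              apply Finset.sum_congr rfl; intro y _
              rw [Finset.mul_sum]
      have h4 : 0 ≤ N * ind (∀ l, ¬ G (C m l) s) :=
        mul_nonneg (Nat.cast_nonneg _) (ind_nonneg _)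
      linarith
    · push Not at h
      rw [ind_true h, mul_one]
      have : ∑ θ, ∑ y, W θ (enc (C m) s) s y * ind (dec C y ≠ m) ≤ N := by
        calc _ ≤ ∑ θ, ∑ y, W θ (enc (C m) s) s y * 1 :=
              Finset.sum_le_sum fun θ _ => Finset.sum_le_sum fun y _ =>
                mul_le_mul_of_nonneg_left (ind_le_one _) (hW0 _ _ _ _)
          _ = N := by simp [hW1, hN]
      linarith
  -- expectation over the codebook
  set w : (Fin L → U) → ℝ := fun c => ∏ l, q (c l) with hw
  have hw0 : ∀ c, 0 ≤ w c := fun c => Finset.prod_nonneg fun l _ => hq0 _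
  have hw1 : ∑ c, w c = 1 := sum_pi_one q hq1
  set ww : (Fin M → Fin L → U) → ℝ := fun C => ∏ m, w (C m) with hww
  have hww0 : ∀ c, 0 ≤ ww c := fun c => Finset.prod_nonneg fun l _ => hw0 _
  have hww1 : ∑ C, ww C = 1 := sum_pi_one w hw1
  have hexp : ∀ (m : Fin M) (s : S), ∑ C, ww C *
      ∑ θ, ∑ y, W θ (enc (C m) s) s y * ind (dec C y ≠ m) ≤
        N * (∑ u, q u * ind (¬ G u s)) ^ L + η + N * (M * (L * β)) := by
    intro m s
    have t1 : ∑ C, ww C * ind (∀ l, ¬ G (C m l) s) = (∑ u, q u * ind (¬ G u s)) ^ L := by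
      rw [hww, E_one w hw1 m (fun c => ind (∀ l, ¬ G (c l) s))]
      simp only [ind_forall, hw]
      rw [E_all q (fun u => ind (¬ G u s)), Fintype.card_fin]
    have t3 : ∀ m' ∈ Finset.univ.erase m, ∑ C, ww C * (∑ θ, ∑ y,
            W θ (enc (C m) s) s y * ∑ l, ind (A (C m' l) y)) ≤ N * (L * β) := by
      intro m' hm'
      have hne : m ≠ m' := (Finset.ne_of_mem_erase hm').symm
      have hH : ∀ y, ∑ c, w c * ∑ l, ind (A (c l) y) ≤ L * β := by
        intro y
        simp only [Finset.mul_sum]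
        rw [Finset.sum_comm]
        calc _ = ∑ l : Fin L, ∑ u, q u * ind (A u y) :=
              Finset.sum_congr rfl fun l _ => E_one q hq1 l (fun u => ind (A u y))
          _ ≤ ∑ l : Fin L, β := Finset.sum_le_sum fun l _ => hβ y
          _ = L * β := by simp
      calc _ = ∑ θ, ∑ y, ∑ C, ww C * (W θ (enc (C m) s) s y * ∑ l, ind (A (C m' l) y)) := by
            simp only [Finset.mul_sum]
            rw [Finset.sum_comm]
            apply Finset.sum_congr rfl; intro θ _
            rw [Finset.sum_comm]
        _ = ∑ θ, ∑ y, (∑ c, w c * W θ (enc c s) s y) * (∑ c, w c * ∑ l, ind (A (c l) y)) :=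
            Finset.sum_congr rfl fun θ _ => Finset.sum_congr rfl fun y _ =>
              E_two w hw1 m m' hne (fun c => W θ (enc c s) s y) (fun c => ∑ l, ind (A (c l) y))
        _ ≤ ∑ θ, ∑ y, (∑ c, w c * W θ (enc c s) s y) * (L * β) :=
            Finset.sum_le_sum fun θ _ => Finset.sum_le_sum fun y _ =>
              mul_le_mul_of_nonneg_left (hH y)
                (Finset.sum_nonneg fun c _ => mul_nonneg (hw0 c) (hW0 _ _ _ _))
        _ = ∑ θ : Θ, (L * β) := by
            apply Finset.sum_congr rfl; intro θ _
            rw [← Finset.sum_mul, Finset.sum_comm]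
            simp only [← Finset.mul_sum, hW1, mul_one, hw1, one_mul]
        _ = _ := by simp [hN]
    calc _ ≤ ∑ C, ww C * (N * ind (∀ l, ¬ G (C m l) s) + η +
          ∑ m' ∈ Finset.univ.erase m, ∑ θ, ∑ y,
            W θ (enc (C m) s) s y * ∑ l, ind (A (C m' l) y)) :=
          Finset.sum_le_sum fun C _ => mul_le_mul_of_nonneg_left (hpt C m s) (hww0 C)
      _ = N * (∑ C, ww C * ind (∀ l, ¬ G (C m l) s)) + (∑ C, ww C) * η +
          ∑ m' ∈ Finset.univ.erase m, ∑ C, ww C * ∑ θ, ∑ y,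
            W θ (enc (C m) s) s y * ∑ l, ind (A (C m' l) y) := by
          simp only [mul_add, Finset.sum_add_distrib]
          congr 1
          · congr 1
            · rw [Finset.mul_sum]
              apply Finset.sum_congr rfl; intro C _; ring
            · rw [Finset.sum_mul]
          · rw [Finset.sum_comm]
            apply Finset.sum_congr rfl; intro C _
            rw [Finset.mul_sum]
      _ ≤ N * (∑ u, q u * ind (¬ G u s)) ^ L + η +
          ∑ m' ∈ Finset.univ.erase m, N * (L * β) := by
          rw [t1, hww1, one_mul]
          gcongr with m' hm'
          exact t3 m' hm'
      _ ≤ N * (∑ u, q u * ind (¬ G u s)) ^ L + η +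
          ∑ m' : Fin M, N * (L * β) := by
          refine add_le_add le_rfl ?_
          apply Finset.sum_le_sum_of_subset_of_nonneg (Finset.erase_subset _ _)
          intro _ _ _
          positivity
      _ = _ := by simp; ring
  set e : (Fin M → Fin L → U) → ℝ := fun C =>
    ∑ m, ∑ θ, ∑ s, PS s * ∑ y, W θ (enc (C m) s) s y * ind (dec C y ≠ m) with he
  set B : ℝ := M * (N * (δ1 + δ2 / η + Real.exp (-(L / T))) + η + N * (M * (L * β))) with hB
  have hEe : ∑ C, ww C * e C ≤ B := by
    have e1 : ∑ C, ww C * e C = ∑ m, ∑ s, PS s * ∑ C, ww C *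
        ∑ θ, ∑ y, W θ (enc (C m) s) s y * ind (dec C y ≠ m) := by
      have : ∀ C, ww C * e C = ∑ m, ∑ s, PS s * (ww C *
        ∑ θ, ∑ y, W θ (enc (C m) s) s y * ind (dec C y ≠ m)) := by
        intro C
        rw [he, Finset.mul_sum]
        apply Finset.sum_congr rfl; intro m _
        rw [Finset.sum_comm, Finset.mul_sum]
        apply Finset.sum_congr rfl; intro s _
        rw [← Finset.mul_sum]; ring
      rw [Finset.sum_congr rfl fun C _ => this C, Finset.sum_comm]
      apply Finset.sum_congr rfl; intro m _
      rw [Finset.sum_comm]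
      apply Finset.sum_congr rfl; intro s _
      rw [Finset.mul_sum]
    rw [e1]
    calc _ ≤ ∑ m : Fin M, ∑ s, PS s * (N * (∑ u, q u * ind (¬ G u s)) ^ L + η + N * (M * (L * β))) :=
          Finset.sum_le_sum fun m _ => Finset.sum_le_sum fun s _ =>
            mul_le_mul_of_nonneg_left (hexp m s) (hPS0 s)
      _ = M * (N * (∑ s, PS s * (∑ u, q u * ind (¬ G u s)) ^ L) + η + N * (M * (L * β))) := by
          rw [Finset.sum_const, Finset.card_univ, Fintype.card_fin, nsmul_eq_mul]
          congr 1
          simp only [mul_add, Finset.sum_add_distrib]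
          rw [← Finset.sum_mul, ← Finset.sum_mul, hPS1, Finset.mul_sum]
          simp only [one_mul]
          congr 2
          apply Finset.sum_congr rfl; intro s _; ring
      _ ≤ B := by
          rw [hB]; gcongr
  obtain ⟨C, hC⟩ : ∃ C, e C ≤ B := by
    by_contra hcon
    push Not at hcon
    have : ∃ C, 0 < ww C := by
      by_contra hz
      push Not at hz
      have : ∑ C, ww C ≤ 0 := Finset.sum_nonpos fun C _ => hz C
      linarith
    obtain ⟨C0, hC0⟩ := this
    have : ∑ C, ww C * B < ∑ C, ww C * e C :=
      Finset.sum_lt_sum (fun C _ => mul_le_mul_of_nonneg_left (hcon C).le (hww0 C))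
        ⟨C0, Finset.mem_univ _, mul_lt_mul_of_pos_left (hcon C0) hC0⟩
    rw [← Finset.sum_mul, hww1, one_mul] at this
    linarith
  exact ⟨fun m s => enc (C m) s, dec C, hC⟩

/-- Expurgation. -/
lemma expurgate
    (PS : S → ℝ) (hPS0 : ∀ s, 0 ≤ PS s)
    (W : Θ → X → S → Y → ℝ) (hW0 : ∀ θ x s y, 0 ≤ W θ x s y)
    (k : ℕ) (hk : 1 ≤ k) (ε : ℝ)
    (φ : Fin (2 * k) → S → X) (ψ : Y → Fin (2 * k))
    (h : ∑ m, ∑ θ, ∑ s, PS s * ∑ y, W θ (φ m s) s y * ind (ψ y ≠ m) ≤ k * ε) :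
    ∃ (φ' : Fin k → S → X) (ψ' : Y → Fin k), ∀ m θ,
      ∑ s, PS s * ∑ y, W θ (φ' m s) s y * ind (ψ' y ≠ m) ≤ ε := by
  classical
  have hnn : ∀ m θ, 0 ≤ ∑ s, PS s * ∑ y, W θ (φ m s) s y * ind (ψ y ≠ m) := fun m θ =>
    Finset.sum_nonneg fun s _ => mul_nonneg (hPS0 s) (Finset.sum_nonneg fun y _ =>
      mul_nonneg (hW0 _ _ _ _) (ind_nonneg _))
  set e : Fin (2 * k) → ℝ := fun m => ∑ θ, ∑ s, PS s * ∑ y, W θ (φ m s) s y * ind (ψ y ≠ m) with he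
  have he0 : ∀ m, 0 ≤ e m := fun m => Finset.sum_nonneg fun θ _ => hnn m θ
  set Gd : Finset (Fin (2 * k)) := Finset.univ.filter (fun m => e m ≤ ε) with hGd
  have hε : 0 ≤ ε := by
    have h0 : 0 ≤ ∑ m, e m := Finset.sum_nonneg fun m _ => he0 m
    have hk' : (1 : ℝ) ≤ k := by exact_mod_cast hk
    have : 0 ≤ k * ε := h0.trans h
    by_contra hc
    push Not at hc
    nlinarith
  have hcard : k ≤ Gd.card := by
    by_contra hlt
    push Not at hlt
    have hc : k + 1 ≤ (Gdᶜ).card := by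
      rw [Finset.card_compl, Fintype.card_fin]; omega
    have hne : (Gdᶜ).Nonempty := by
      rw [← Finset.card_pos]; omega
    have h1 : ∑ m ∈ Gdᶜ, ε < ∑ m ∈ Gdᶜ, e m := by
      apply Finset.sum_lt_sum_of_nonempty hne
      intro m hm
      simp only [hGd, Finset.mem_compl, Finset.mem_filter, Finset.mem_univ, true_and, not_le] at hm
      exact hm
    have h2 : ∑ m ∈ Gdᶜ, e m ≤ ∑ m, e m :=
      Finset.sum_le_sum_of_subset_of_nonneg (Finset.subset_univ _) fun m _ _ => he0 m
    rw [Finset.sum_const, nsmul_eq_mul] at h1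
    have h3 : ((k : ℝ) + 1) ≤ ((Gdᶜ).card : ℝ) := by exact_mod_cast hc
    have h4 : ∑ m, e m ≤ k * ε := h
    nlinarith
  obtain ⟨t, htG, htc⟩ := Finset.exists_subset_card_eq hcard
  let f : Fin k ↪ Fin (2 * k) := (t.orderEmbOfFin htc).toEmbedding
  have hf : ∀ m, f m ∈ Gd := fun m => htG (Finset.orderEmbOfFin_mem t htc m)
  refine ⟨fun m => φ (f m), fun y => if h : ∃ m, f m = ψ y then h.choose else ⟨0, hk⟩, ?_⟩
  intro m θ
  have hm : e (f m) ≤ ε := by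
    have := hf m
    simp only [hGd, Finset.mem_filter, Finset.mem_univ, true_and] at this
    exact this
  refine le_trans ?_ (le_trans (Finset.single_le_sum (fun θ _ => hnn (f m) θ)
    (Finset.mem_univ θ)) hm)
  apply Finset.sum_le_sum; intro s _
  apply mul_le_mul_of_nonneg_left _ (hPS0 s)
  apply Finset.sum_le_sum; intro y _
  apply mul_le_mul_of_nonneg_left _ (hW0 _ _ _ _)
  apply ind_mono
  intro hne heq
  apply hne
  have hex : ∃ m, f m = ψ y := ⟨m, heq.symm⟩
  simp only [dif_pos hex]
  apply f.injective
  rw [hex.choose_spec, heq]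

end OneShot

section Core

variable {U S X Y Θ : Type} [Fintype U] [Fintype S] [Fintype X] [Fintype Y] [Fintype Θ]

lemma beta_bound (p : U × Y → ℝ) (hp : ∀ z, 0 ≤ p z) (n : ℕ) (T : ℝ) (hT : 0 < T)
    (y : Fin n → Y) :
    ∑ u : Fin n → U, (∏ i, ∑ b', p (u i, b')) *
      ind (0 < ∏ i, p (u i, y i) ∧ T * ((∏ i, ∑ b', p (u i, b')) * ∏ i, ∑ a', p (a', y i))
        ≤ ∏ i, p (u i, y i)) ≤ T⁻¹ := by
  set D : ℝ := ∏ i, ∑ a', p (a', y i) with hD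
  have hDs : ∑ u : Fin n → U, ∏ i, p (u i, y i) = D := sum_pi_prod (fun i a => p (a, y i))
  have hnn : ∀ u : Fin n → U, 0 ≤ ∏ i, p (u i, y i) := fun u => Finset.prod_nonneg fun i _ => hp _
  have hD0 : 0 ≤ D := by rw [← hDs]; exact Finset.sum_nonneg fun u _ => hnn u
  rcases hD0.eq_or_lt with h | h
  · have hz : ∀ u : Fin n → U, ∏ i, p (u i, y i) = 0 := by
      intro u
      have := (Finset.sum_eq_zero_iff_of_nonneg (fun u _ => hnn u)).mp (hDs.trans h.symm) u
        (Finset.mem_univ u)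
      exact this
    rw [Finset.sum_eq_zero]
    · exact (inv_pos.mpr hT).le
    · intro u _
      rw [ind_false, mul_zero]
      rintro ⟨h1, _⟩
      rw [hz u] at h1
      exact lt_irrefl _ h1
  · calc _ ≤ ∑ u : Fin n → U, (T⁻¹ * D⁻¹) * ∏ i, p (u i, y i) := by
          apply Finset.sum_le_sum
          intro u _
          by_cases hA : 0 < ∏ i, p (u i, y i) ∧ T * ((∏ i, ∑ b', p (u i, b')) * D)
            ≤ ∏ i, p (u i, y i)
          · rw [ind_true hA, mul_one]
            have h2 := hA.2
            have : (T⁻¹ * D⁻¹) * (T * ((∏ i, ∑ b', p (u i, b')) * D)) = ∏ i, ∑ b', p (u i, b') := by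
              field_simp
            rw [← this]
            exact mul_le_mul_of_nonneg_left h2 (by positivity)
          · rw [ind_false hA, mul_zero]
            exact mul_nonneg (by positivity) (hnn u)
      _ = T⁻¹ := by
          rw [← Finset.mul_sum, hDs]; field_simp
      _ ≤ T⁻¹ := le_rfl

lemma core [Nonempty X]
    (ps : S → ℝ) (hps0 : ∀ s, 0 ≤ ps s) (hps1 : ∑ s, ps s = 1)
    (kk : S → X → U → ℝ) (hk0 : ∀ s x u, 0 ≤ kk s x u) (hk1 : ∀ s, ∑ u, ∑ x, kk s x u = 1)
    (w : Θ → X → S → Y → ℝ) (hw0 : ∀ θ x s y, 0 ≤ w θ x s y) (hw1 : ∀ θ x s, ∑ y, w θ x s y = 1)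
    (pUS : U × S → ℝ) (hpUS : pUS = fun z => ps z.2 * ∑ x, kk z.2 x z.1)
    (pUY : Θ → U × Y → ℝ)
    (hpUY : pUY = fun θ z => ∑ s, ∑ x, ps s * kk s x z.1 * w θ x s z.2)
    (aS aY : ℝ) (haS : mutualInfo pUS < aS) (haY : ∀ θ, aY < mutualInfo (pUY θ)) :
    ∃ (ρ : ℝ) (r : Θ → ℝ), 0 ≤ ρ ∧ ρ < 1 ∧ (∀ θ, 0 ≤ r θ ∧ r θ < 1) ∧
      ∀ (n M L : ℕ) (η : ℝ), 0 < η → 1 ≤ M →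
      ∃ (φ : Fin M → (Fin n → S) → (Fin n → X)) (ψ : (Fin n → Y) → Fin M),
        ∑ m, ∑ θ, ∑ s : Fin n → S, (∏ i, ps (s i)) * ∑ y : Fin n → Y,
          (∏ i, w θ (φ m s i) (s i) (y i)) * ind (ψ y ≠ m) ≤
        M * (Fintype.card Θ * (ρ ^ n + (∑ θ, r θ ^ n) / η + Real.exp (-(L / Real.exp (n * aS)))) + η
          + Fintype.card Θ * (M * (L * (Fintype.card Θ * (Real.exp (n * aY))⁻¹)))) := by
  classical
  have hUS0 : ∀ z, 0 ≤ pUS z := fun z => by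
    rw [hpUS]; exact mul_nonneg (hps0 _) (Finset.sum_nonneg fun x _ => hk0 _ _ _)
  have hUY0 : ∀ θ z, 0 ≤ pUY θ z := fun θ z => by
    rw [hpUY]; exact Finset.sum_nonneg fun s _ => Finset.sum_nonneg fun x _ =>
      mul_nonneg (mul_nonneg (hps0 _) (hk0 _ _ _)) (hw0 _ _ _ _)
  have hmS : ∀ s, ∑ u, pUS (u, s) = ps s := fun s => by
    rw [hpUS]; simp only; rw [← Finset.mul_sum, hk1, mul_one]
  have hUS1 : ∑ z, pUS z = 1 := by
    rw [Fintype.sum_prod_type_right]; simp only [hmS, hps1]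
  have hmU : ∀ θ u, ∑ y, pUY θ (u, y) = ∑ s, pUS (u, s) := fun θ u => by
    rw [hpUY, hpUS]; simp only
    rw [Finset.sum_comm]
    apply Finset.sum_congr rfl; intro s _
    rw [Finset.sum_comm, Finset.mul_sum]
    apply Finset.sum_congr rfl; intro x _
    rw [← Finset.mul_sum, hw1, mul_one]
  have hUY1 : ∀ θ, ∑ z, pUY θ z = 1 := fun θ => by
    rw [Fintype.sum_prod_type]; simp only [hmU]; rw [← Fintype.sum_prod_type, hUS1]
  obtain ⟨ρ, hρ0, hρ1, hρ⟩ := mi_upper pUS hUS0 hUS1 aS haS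
  choose r hr0 hr1 hr using fun θ => mi_lower (pUY θ) (hUY0 θ) (hUY1 θ) aY (haY θ)
  refine ⟨ρ, r, hρ0, hρ1, fun θ => ⟨hr0 θ, hr1 θ⟩, ?_⟩
  intro n M L η hη hM
  have hUSn : ∀ (u : Fin n → U) (s : Fin n → S),
      (∏ i, ps (s i)) * ∑ x : Fin n → X, ∏ i, kk (s i) (x i) (u i) = ∏ i, pUS (u i, s i) := by
    intro u s
    rw [sum_pi_prod (fun i a => kk (s i) a (u i)), ← Finset.prod_mul_distrib, hpUS]
  have hUYn : ∀ θ (u : Fin n → U) (y : Fin n → Y),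
      ∑ s : Fin n → S, ∑ x : Fin n → X, (∏ i, ps (s i)) * (∏ i, kk (s i) (x i) (u i)) *
        (∏ i, w θ (x i) (s i) (y i)) = ∏ i, pUY θ (u i, y i) := by
    intro θ u y
    rw [sum_pair_fn]
    simp only [← Finset.prod_mul_distrib]
    rw [sum_pi_prod (fun i (a : S × X) => ps a.1 * kk a.1 a.2 (u i) * w θ a.2 a.1 (y i)), hpUY]
    apply Finset.prod_congr rfl; intro i _
    rw [Fintype.sum_prod_type]
  apply oneshot (fun s : Fin n → S => ∏ i, ps (s i))
    (fun s => Finset.prod_nonneg fun i _ => hps0 _) (sum_pi_one ps hps1)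
    (fun u : Fin n → U => ∏ i, ∑ s, pUS (u i, s))
    (fun u => Finset.prod_nonneg fun i _ => Finset.sum_nonneg fun s _ => hUS0 _)
    (sum_pi_one (fun u => ∑ s, pUS (u, s)) (by rw [← Fintype.sum_prod_type, hUS1]))
    (fun (s : Fin n → S) (x : Fin n → X) (u : Fin n → U) => ∏ i, kk (s i) (x i) (u i))
    (fun s x u => Finset.prod_nonneg fun i _ => hk0 _ _ _)
    (fun s => by
      have : ∀ u : Fin n → U, ∑ x : Fin n → X, ∏ i, kk (s i) (x i) (u i) =
        ∏ i, ∑ x, kk (s i) x (u i) := fun u => sum_pi_prod (fun i a => kk (s i) a (u i))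
      rw [Finset.sum_congr rfl fun u _ => this u,
        sum_pi_prod (fun i a => ∑ x, kk (s i) x a)]
      simp [hk1])
    (fun θ (x : Fin n → X) (s : Fin n → S) (y : Fin n → Y) => ∏ i, w θ (x i) (s i) (y i))
    (fun θ x s y => Finset.prod_nonneg fun i _ => hw0 _ _ _ _)
    (fun θ x s => by
      rw [sum_pi_prod (fun i a => w θ (x i) (s i) a)]; simp [hw1])
    (fun u y => ∃ θ, 0 < ∏ i, pUY θ (u i, y i) ∧ Real.exp (n * aY) *
          ((∏ i, ∑ b', pUY θ (u i, b')) * ∏ i, ∑ a', pUY θ (a', y i)) ≤ ∏ i, pUY θ (u i, y i))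
    (Real.exp (n * aS)) (Fintype.card Θ * (Real.exp (n * aY))⁻¹) (ρ ^ n) (∑ θ, r θ ^ n) η
    (Real.exp_pos _) hη (by positivity)
  · intro y
    calc _ ≤ ∑ u : Fin n → U, (∏ i, ∑ s, pUS (u i, s)) * ∑ θ, ind (0 < ∏ i, pUY θ (u i, y i) ∧
          Real.exp (n * aY) * ((∏ i, ∑ b', pUY θ (u i, b')) * ∏ i, ∑ a', pUY θ (a', y i))
            ≤ ∏ i, pUY θ (u i, y i)) :=
          Finset.sum_le_sum fun u _ => mul_le_mul_of_nonneg_left (ind_exists_le _)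
            (Finset.prod_nonneg fun i _ => Finset.sum_nonneg fun s _ => hUS0 _)
      _ = ∑ θ, ∑ u : Fin n → U, (∏ i, ∑ b', pUY θ (u i, b')) * ind (0 < ∏ i, pUY θ (u i, y i) ∧
          Real.exp (n * aY) * ((∏ i, ∑ b', pUY θ (u i, b')) * ∏ i, ∑ a', pUY θ (a', y i))
            ≤ ∏ i, pUY θ (u i, y i)) := by
          simp only [Finset.mul_sum]
          rw [Finset.sum_comm]
          simp only [hmU]
      _ ≤ ∑ θ : Θ, (Real.exp (n * aY))⁻¹ :=
          Finset.sum_le_sum fun θ _ => beta_bound (pUY θ) (hUY0 θ) n _ (Real.exp_pos _) y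
      _ = _ := by simp
  · simp only [hUSn]
    have := hρ n
    simp only [hmS] at this
    exact this
  · simp only [hUYn]
    apply Finset.sum_le_sum
    intro θ _
    refine le_trans ?_ (hr θ n)
    apply Finset.sum_le_sum; intro u _
    apply Finset.sum_le_sum; intro y _
    apply mul_le_mul_of_nonneg_left _ (Finset.prod_nonneg fun i _ => hUY0 θ _)
    apply ind_mono
    intro h h'
    exact h ⟨θ, h'⟩
  · exact hM

end Core

lemma pmf_sum_one {α : Type} [Fintype α] (p : PMF α) : ∑ a, (p a).toReal = 1 := by
  rw [← ENNReal.toReal_sum (fun a _ => p.apply_ne_top a), ← tsum_fintype (L := .unconditional _),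
    p.tsum_coe]
  simp

lemma avgError_eq {Θ : Type} (W : Θ → 𝒳 → 𝒮 → PMF 𝒴) (PS : PMF 𝒮) {n M : ℕ}
    (φ : Fin M → (Fin n → 𝒮) → (Fin n → 𝒳)) (ψ : (Fin n → 𝒴) → Fin M)
    (m : Fin M) (θ : Θ) : avgError W PS φ ψ m θ =
    ∑ s : Fin n → 𝒮, (∏ i, (PS (s i)).toReal) * ∑ y : Fin n → 𝒴,
      (∏ i, ((W θ (φ m s i) (s i)) (y i)).toReal) * ind (ψ y ≠ m) := by
  unfold avgError
  apply Finset.sum_congr rfl; intro s _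
  congr 1
  apply Finset.sum_congr rfl; intro y _
  congr 1
  by_cases h : ψ y ≠ m
  · rw [ind_true h, if_pos h]
  · rw [ind_false h, if_neg h]

lemma asymp {Θ : Type} [Fintype Θ] (ρ : ℝ) (r : Θ → ℝ) (hρ0 : 0 ≤ ρ) (hρ1 : ρ < 1)
    (hr : ∀ θ, 0 ≤ r θ ∧ r θ < 1) (N τ ε : ℝ) (hτ0 : 0 ≤ τ) (hτ1 : τ < 1) (hε : 0 < ε) :
    ∃ n₀ : ℕ, ∀ n ≥ n₀, N * (ρ ^ n + (∑ θ, r θ ^ n) / (ε / 4) + τ ^ n) + ε / 4 +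
      N * (N * (8 * τ ^ n)) ≤ ε / 2 := by
  have h1 := tendsto_pow_atTop_nhds_zero_of_lt_one hρ0 hρ1
  have h2 := tendsto_pow_atTop_nhds_zero_of_lt_one hτ0 hτ1
  have h3 : Filter.Tendsto (fun n : ℕ => ∑ θ, r θ ^ n) Filter.atTop (nhds (∑ _θ : Θ, (0 : ℝ))) :=
    tendsto_finsetSum _ fun θ _ => tendsto_pow_atTop_nhds_zero_of_lt_one (hr θ).1 (hr θ).2
  have h4 := ((((h1.add (h3.div_const (ε / 4))).add h2).const_mul N).add_const (ε / 4)).add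
    (((h2.const_mul 8).const_mul N).const_mul N)
  have h5 : N * (0 + (∑ _θ : Θ, (0 : ℝ)) / (ε / 4) + 0) + ε / 4 + N * (N * (8 * 0)) < ε / 2 := by
    simp; linarith
  obtain ⟨n₀, hn⟩ := Filter.eventually_atTop.mp (h4.eventually_lt_const h5)
  exact ⟨n₀, fun n hn' => (hn n hn').le⟩

/-- The straightforward extension of the Gel'fand–Pinsker rate to the compound
setting: for any conditional input distribution `P_{XU|S}` the rate
`max(0, min_θ [I(U;Y_θ) − I(U;S)])` is achievable for the compound DMC with
states known non-causally at the transmitter only, where all mutual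
informations are computed from the joint pmf
`p_θ(u,s,x,y) = P_S(s)·P_{XU|S}(s)(x,u)·(W θ x s)(y)`. -/
theorem gelfand_pinsker_compound_lower_bound
    {Θ 𝒰 : Type} [Fintype Θ] [Nonempty Θ] [Fintype 𝒰] [Nonempty 𝒰]
    (W : Θ → 𝒳 → 𝒮 → PMF 𝒴) (PS : PMF 𝒮) (PXU : 𝒮 → PMF (𝒳 × 𝒰)) :
    IsAchievable W PS
      (max 0 (Finset.univ.inf' Finset.univ_nonempty (fun θ : Θ =>
        mutualInfo (fun q : 𝒰 × 𝒴 =>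
          ∑ s : 𝒮, ∑ x : 𝒳,
            (PS s).toReal * ((PXU s) (x, q.1)).toReal * ((W θ x s) q.2).toReal) -
        mutualInfo (fun q : 𝒰 × 𝒮 =>
          ∑ x : 𝒳, ∑ y : 𝒴,
            (PS q.2).toReal * ((PXU q.2) (x, q.1)).toReal * ((W θ x q.2) y).toReal)))) := by
  classical
  have hS : Nonempty 𝒮 := by
    obtain ⟨s, _⟩ := PS.support_nonempty
    exact ⟨s⟩
  have hX : Nonempty 𝒳 := by
    obtain ⟨z, _⟩ := (PXU hS.some).support_nonempty
    exact ⟨z.1⟩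
  have hW1 : ∀ θ x s, ∑ y, ((W θ x s) y).toReal = 1 := fun θ x s => pmf_sum_one _
  have hPS1 := pmf_sum_one PS
  have hK1 : ∀ s, ∑ u, ∑ x, ((PXU s) (x, u)).toReal = 1 := fun s => by
    rw [← Fintype.sum_prod_type_right (f := fun z : 𝒳 × 𝒰 => ((PXU s) z).toReal)]
    exact pmf_sum_one _
  set pUS : 𝒰 × 𝒮 → ℝ := fun z => (PS z.2).toReal * ∑ x, ((PXU z.2) (x, z.1)).toReal with hpUS
  set pUY : Θ → 𝒰 × 𝒴 → ℝ := fun θ z => ∑ s : 𝒮, ∑ x : 𝒳,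
            (PS s).toReal * ((PXU s) (x, z.1)).toReal * ((W θ x s) z.2).toReal with hpUY
  have e1 : ∀ θ, (fun q : 𝒰 × 𝒮 =>
          ∑ x : 𝒳, ∑ y : 𝒴,
            (PS q.2).toReal * ((PXU q.2) (x, q.1)).toReal * ((W θ x q.2) y).toReal) = pUS := by
    intro θ
    funext q
    simp only [← Finset.mul_sum, hW1, mul_one, hpUS]
  simp only [e1]
  set I : ℝ := mutualInfo pUS with hI
  have hI0 : 0 ≤ I := by
    apply mutualInfo_nonneg
    · intro z
      exact mul_nonneg ENNReal.toReal_nonneg (Finset.sum_nonneg fun x _ => ENNReal.toReal_nonneg)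
    · rw [Fintype.sum_prod_type_right]
      simp only [hpUS, ← Finset.mul_sum, hK1, mul_one, hPS1]
  set R0 : ℝ := Finset.univ.inf' Finset.univ_nonempty (fun θ : Θ => mutualInfo (pUY θ) - I) with hR0
  have hR0le : ∀ θ, R0 ≤ mutualInfo (pUY θ) - I := fun θ =>
    Finset.inf'_le (fun θ : Θ => mutualInfo (pUY θ) - I) (Finset.mem_univ θ)
  change IsAchievable W PS (max 0 R0)
  refine ⟨le_max_left _ _, ?_⟩
  rintro ε ⟨hε0, hε1⟩ γ ⟨hγ0, hγ1⟩
  by_cases hRγ : R0 ≤ γ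
  · refine ⟨0, fun n _ => ⟨1, le_rfl, fun _ _ _ => hX.some, fun _ => 0, ?_, ?_⟩⟩
    · have : max 0 R0 ≤ γ := max_le hγ0.le hRγ
      simp
      exact ⟨hγ0.le, hRγ⟩
    · intro m θ
      rw [avgError_eq]
      have hm : ind ((0 : Fin 1) ≠ m) = 0 :=
        ind_false (not_not.mpr (Subsingleton.elim _ _))
      simp only [hm, mul_zero, Finset.sum_const_zero]
      exact hε0.le
  · push Not at hRγ
    have hmax : max 0 R0 = R0 := max_eq_right (hγ0.trans hRγ).le
    rw [hmax]
    obtain ⟨ρ, r, hρ0, hρ1, hr, hcore⟩ := core (fun s => (PS s).toReal)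
      (fun s => ENNReal.toReal_nonneg) hPS1 (fun s x u => ((PXU s) (x, u)).toReal)
      (fun s x u => ENNReal.toReal_nonneg) hK1 (fun θ x s y => ((W θ x s) y).toReal)
      (fun θ x s y => ENNReal.toReal_nonneg) hW1 pUS hpUS pUY hpUY
      (I + γ / 4) (R0 + I - γ / 4) (by linarith) (fun θ => by linarith [hR0le θ])
    set N : ℝ := (Fintype.card Θ : ℝ) with hN
    have hN0 : 0 ≤ N := Nat.cast_nonneg _
    set τ : ℝ := Real.exp (-(γ / 4)) with hτ
    have hτ0 : 0 ≤ τ := Real.exp_nonneg _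
    have hτ1 : τ < 1 := by rw [hτ, ← Real.exp_zero]; exact Real.exp_lt_exp.mpr (by linarith)
    obtain ⟨n₀, hn₀⟩ := asymp ρ r hρ0 hρ1 hr N τ ε hτ0 hτ1 hε0
    refine ⟨max n₀ 1, fun n hn => ?_⟩
    have hn1 : 1 ≤ n := le_trans (le_max_right _ _) hn
    have hB := hn₀ n (le_trans (le_max_left _ _) hn)
    have hnR : (1 : ℝ) ≤ n := by exact_mod_cast hn1
    set L : ℕ := ⌈Real.exp (n * (I + 2 * (γ / 4)))⌉₊ with hL
    set k : ℕ := ⌈Real.exp (n * (R0 - γ))⌉₊ with hk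
    have hLge : Real.exp (n * (I + 2 * (γ / 4))) ≤ L := Nat.le_ceil _
    have hkge : Real.exp (n * (R0 - γ)) ≤ k := Nat.le_ceil _
    have hLle : (L : ℝ) ≤ 2 * Real.exp (n * (I + 2 * (γ / 4))) := by
      have h1 := (Nat.ceil_lt_add_one (Real.exp_nonneg (n * (I + 2 * (γ / 4))))).le
      have h2 : 1 ≤ Real.exp (n * (I + 2 * (γ / 4))) := Real.one_le_exp (by positivity)
      rw [← hL] at h1
      linarith
    have hkle : (k : ℝ) ≤ 2 * Real.exp (n * (R0 - γ)) := by
      have h1 := (Nat.ceil_lt_add_one (Real.exp_nonneg (n * (R0 - γ)))).le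
      have h2 : 1 ≤ Real.exp (n * (R0 - γ)) :=
        Real.one_le_exp (mul_nonneg (by linarith) (by linarith))
      rw [← hk] at h1
      linarith
    have hk1 : 1 ≤ k := Nat.one_le_ceil_iff.mpr (Real.exp_pos _)
    have hkpos : (0 : ℝ) < k := by exact_mod_cast hk1
    obtain ⟨φ, ψ, hφψ⟩ := hcore n (2 * k) L (ε / 4) (by linarith) (by omega)
    have hτn : Real.exp (n * -(γ / 4)) = τ ^ n := by rw [hτ, ← Real.exp_nat_mul]
    have t1 : Real.exp (-(L / Real.exp (n * (I + γ / 4)))) ≤ τ ^ n := by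
      rw [← hτn]
      apply Real.exp_le_exp.mpr
      have h1 : Real.exp (n * (γ / 4)) ≤ L / Real.exp (n * (I + γ / 4)) := by
        rw [le_div_iff₀ (Real.exp_pos _), ← Real.exp_add]
        refine le_trans (le_of_eq ?_) hLge
        congr 1; ring
      have h2 := Real.add_one_le_exp (n * (γ / 4))
      linarith
    have t2 : ((2 * k : ℕ) : ℝ) * (L * (N * (Real.exp (n * (R0 + I - γ / 4)))⁻¹)) ≤
        N * (8 * τ ^ n) := by
      rw [← hτn]
      calc _ ≤ (2 * (2 * Real.exp (n * (R0 - γ)))) * ((2 * Real.exp (n * (I + 2 * (γ / 4)))) *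
            (N * (Real.exp (n * (R0 + I - γ / 4)))⁻¹)) := by
            push_cast
            gcongr
        _ = N * (8 * (Real.exp (n * (R0 - γ)) * Real.exp (n * (I + 2 * (γ / 4))) *
            (Real.exp (n * (R0 + I - γ / 4)))⁻¹)) := by ring
        _ = _ := by
            rw [← Real.exp_neg, ← Real.exp_add, ← Real.exp_add]
            congr 3; ring
    have hfin : ∑ m, ∑ θ, ∑ s : Fin n → 𝒮, (∏ i, (PS (s i)).toReal) * ∑ y : Fin n → 𝒴,
          (∏ i, ((W θ (φ m s i) (s i)) (y i)).toReal) * ind (ψ y ≠ m) ≤ k * ε := by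
      refine le_trans hφψ ?_
      calc _ ≤ ((2 * k : ℕ) : ℝ) * (ε / 2) := by
            apply mul_le_mul_of_nonneg_left _ (Nat.cast_nonneg _)
            refine le_trans ?_ hB
            gcongr
        _ = k * ε := by push_cast; ring
    obtain ⟨φ', ψ', hfinal⟩ := expurgate (fun s : Fin n → 𝒮 => ∏ i, (PS (s i)).toReal)
      (fun s => Finset.prod_nonneg fun i _ => ENNReal.toReal_nonneg)
      (fun θ (x : Fin n → 𝒳) (s : Fin n → 𝒮) (y : Fin n → 𝒴) =>
        ∏ i, ((W θ (x i) (s i)) (y i)).toReal)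
      (fun θ x s y => Finset.prod_nonneg fun i _ => ENNReal.toReal_nonneg)
      k hk1 ε φ ψ hfin
    refine ⟨k, hk1, φ', ψ', ?_, ?_⟩
    · rw [ge_iff_le, le_div_iff₀ (by linarith), Real.le_log_iff_exp_le hkpos]
      refine le_trans (le_of_eq ?_) hkge
      congr 1; ring
    · intro m θ
      rw [avgError_eq]
      exact hfinal m θ

end CompoundGP
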